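/- Let (R, m) be a complete n-dimensional Gorenstein local ring and I ⊂ R an ideal of height c. Then the endomorphism ring B = Hom_R(H^c_I(R), H^c_I(R)) is m-adically complete, i.e. the natural map B → lim_α B/m^α B is an isomorphism. -/

import Mathlib

open CategoryTheory CategoryTheory.Limits Opposite IsLocalRing

noncomputable section

universe u

/-- The `i`-th local cohomology of the `R`-module `M` with support in the ideal `J`,
defined (following Mathlib) as the direct limit of `Ext^i(R/J^α, M)`. -/
abbrev LC (R : Type u) [CommRing R] (J : Ideal R) (i : ℕ) (M : ModuleCat.{u} R) :
    ModuleCat.{u} R :=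
  (localCohomology J i).obj M

/-- `Ext^i_R(M, N)` as an `R`-module. -/
abbrev ExtM (R : Type u) [CommRing R] (i : ℕ) (M N : ModuleCat.{u} R) : ModuleCat.{u} R :=
  ((Ext R (ModuleCat.{u} R) i).obj (op M)).obj N

/-- The height of an ideal: the infimum of the heights of the primes containing it. -/
def idealHeight (R : Type u) [CommRing R] (I : Ideal R) : ℕ∞ :=
  ⨅ p : {p : PrimeSpectrum R // I ≤ p.asIdeal}, Order.height (p : PrimeSpectrum R)

/-- A Noetherian local ring `(R, 𝔪, k)` is Gorenstein if `Ext^i_R(k, R)` vanishes for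
`i ≠ dim R` and is isomorphic to `k` in degree `dim R`. -/
def IsGorensteinLocalRing (R : Type u) [CommRing R] [IsLocalRing R] : Prop :=
  IsNoetherianRing R ∧
    ∃ n : ℕ, ringKrullDim R = n ∧
      (∀ i : ℕ, i ≠ n →
        Subsingleton (ExtM R i (ModuleCat.of R (R ⧸ maximalIdeal R)) (ModuleCat.of R R))) ∧
      Nonempty ((ExtM R n (ModuleCat.of R (R ⧸ maximalIdeal R)) (ModuleCat.of R R)) ≃ₗ[R]
        (R ⧸ maximalIdeal R))

namespace HomologicalComplex

variable {R : Type u} [CommRing R] {ι : Type*} {c : ComplexShape ι}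

/-- The homology class of a cycle in a complex of modules. -/
def moduleCatClass (K : HomologicalComplex (ModuleCat.{u} R) c) (i : ι) :
    LinearMap.ker (K.d i (c.next i)).hom →ₗ[R] K.homology i :=
  (K.liftCycles (ModuleCat.ofHom (LinearMap.ker (K.d i (c.next i)).hom).subtype) (c.next i) rfl
    (by ext x; exact x.2) ≫ K.homologyπ i).hom

variable (K : HomologicalComplex (ModuleCat.{u} R) c) (i : ι)

lemma moduleCatClass_eq_of_cycle (x : K.cycles i)
    (z : LinearMap.ker (K.d i (c.next i)).hom) (h : K.iCycles i x = z.1) :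
    K.moduleCatClass i z = K.homologyπ i x := by
  have : K.liftCycles (ModuleCat.ofHom (LinearMap.ker (K.d i (c.next i)).hom).subtype)
      (c.next i) rfl (by ext x; exact x.2) z = x := by
    apply (ModuleCat.mono_iff_injective (K.iCycles i)).1 inferInstance
    rw [h, ← ModuleCat.comp_apply, liftCycles_i]
    rfl
  rw [← this]
  rfl

lemma moduleCatClass_surjective : Function.Surjective (K.moduleCatClass i) := by
  intro y
  obtain ⟨x, rfl⟩ := (ModuleCat.epi_iff_surjective (K.homologyπ i)).1 inferInstance y
  refine ⟨⟨K.iCycles i x, ?_⟩, K.moduleCatClass_eq_of_cycle i x _ rfl⟩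
  rw [LinearMap.mem_ker, ← ModuleCat.comp_apply, iCycles_d]
  rfl

lemma exists_iCycles_eq (z : LinearMap.ker (K.d i (c.next i)).hom) :
    ∃ x : K.cycles i, K.iCycles i x = z.1 := by
  refine ⟨K.liftCycles (ModuleCat.ofHom (LinearMap.ker (K.d i (c.next i)).hom).subtype)
    (c.next i) rfl (by ext x; exact x.2) z, ?_⟩
  rw [← ModuleCat.comp_apply, liftCycles_i]
  rfl

lemma moduleCatClass_eq_zero_iff (z : LinearMap.ker (K.d i (c.next i)).hom) :
    K.moduleCatClass i z = 0 ↔ ∃ y : K.X (c.prev i), K.d (c.prev i) i y = z.1 := by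
  have hE : (ShortComplex.mk _ _ (K.toCycles_comp_homologyπ (c.prev i) i)).Exact :=
    ShortComplex.exact_of_g_is_cokernel _ (K.homologyIsCokernel (c.prev i) i rfl)
  rw [ShortComplex.moduleCat_exact_iff] at hE
  obtain ⟨x, hx⟩ := K.exists_iCycles_eq i z
  rw [K.moduleCatClass_eq_of_cycle i x z hx]
  constructor
  · intro h
    obtain ⟨y, hy⟩ := hE _ h
    refine ⟨y, ?_⟩
    rw [← hx, ← hy, ← ModuleCat.comp_apply, toCycles_i]
  · rintro ⟨y, hy⟩
    have : K.toCycles (c.prev i) i y = x := by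
      apply (ModuleCat.mono_iff_injective (K.iCycles i)).1 inferInstance
      rw [hx, ← hy, ← ModuleCat.comp_apply, toCycles_i]
    rw [← this, ← ModuleCat.comp_apply, toCycles_comp_homologyπ]
    rfl

variable {K i}

lemma homologyMap_moduleCatClass {L : HomologicalComplex (ModuleCat.{u} R) c} (φ : K ⟶ L)
    (z : LinearMap.ker (K.d i (c.next i)).hom) (w : LinearMap.ker (L.d i (c.next i)).hom)
    (h : φ.f i z.1 = w.1) :
    homologyMap φ i (K.moduleCatClass i z) = L.moduleCatClass i w := by
  obtain ⟨x, hx⟩ := K.exists_iCycles_eq i z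
  rw [K.moduleCatClass_eq_of_cycle i x z hx, ← ModuleCat.comp_apply, homologyπ_naturality,
    L.moduleCatClass_eq_of_cycle i (cyclesMap φ i x) w]
  · rfl
  · rw [← ModuleCat.comp_apply, cyclesMap_i, ModuleCat.comp_apply, hx, h]

end HomologicalComplex

namespace ExtComparison

variable {R : Type u} [CommRing R]

/-- Precomposition with a morphism of chain complexes, as a morphism of cochain complexes of
modules. -/
def linearYonedaMap {K L : ChainComplex (ModuleCat.{u} R) ℕ} (φ : K ⟶ L) (Y : ModuleCat.{u} R) :
    L.linearYonedaObj R Y ⟶ K.linearYonedaObj R Y :=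
  (HomologicalComplex.unopFunctor _ _).map
    (((((linearYoneda R (ModuleCat.{u} R)).obj Y).rightOp.mapHomologicalComplex _).map φ).op)

lemma comp_unop_conj {V : Type*} [Category* V] {L L' H H' : Vᵒᵖ} (i : L ≅ H)
    (i' : L' ≅ H') (M : H ⟶ H') {h h' : V} (a : h ⟶ unop H) (a' : h' ⟶ unop H') (m : h' ⟶ h)
    (hm : a' ≫ M.unop = m ≫ a) :
    (a' ≫ i'.hom.unop) ≫ (i.hom ≫ M ≫ i'.inv).unop = m ≫ a ≫ i.hom.unop := by
  have h : i'.hom.unop ≫ i'.inv.unop = 𝟙 _ := by rw [← unop_comp, i'.inv_hom_id, unop_id]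
  simp only [unop_comp, Category.assoc, reassoc_of% h, reassoc_of% hm]

lemma isoExt_inv_naturality {X X' : ModuleCat.{u} R} (Y : ModuleCat.{u} R) (f : X ⟶ X')
    (P : ProjectiveResolution X) (P' : ProjectiveResolution X') (φ : P.complex ⟶ P'.complex)
    (w : φ ≫ P'.π = P.π ≫ (ChainComplex.single₀ _).map f) (n : ℕ) :
    (P'.isoExt (R := R) n Y).inv ≫ ((Ext R (ModuleCat.{u} R) n).map f.op).app Y =
      HomologicalComplex.homologyMap (linearYonedaMap φ Y) n ≫ (P.isoExt n Y).inv := by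
  have h : ((Ext R (ModuleCat.{u} R) n).map f.op).app Y =
    ((((linearYoneda R _).obj Y).rightOp.leftDerived n).map f).unop := rfl
  rw [h, Functor.leftDerived_map_eq _ n f φ w]
  exact comp_unop_conj _ _ _ _ _ _
    (congrArg Quiver.Hom.unop
      (HomologicalComplex.homologyOp_hom_naturality (linearYonedaMap φ Y) n))

variable {X : ModuleCat.{u} R} (P : ProjectiveResolution X) (n : ℕ) (Y : ModuleCat.{u} R)

/-- The `n`-cocycles in `Hom(P, Y)` for a projective resolution `P`. -/
abbrev cocycles : Submodule R ((P.complex.linearYonedaObj R Y).X n) :=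
  LinearMap.ker ((P.complex.linearYonedaObj R Y).d n ((ComplexShape.up ℕ).next n)).hom

variable {P n Y}

lemma mem_cocycles_iff (f : P.complex.X n ⟶ Y) :
    (show (P.complex.linearYonedaObj R Y).X n from f) ∈ cocycles P n Y ↔
      P.complex.d ((ComplexShape.up ℕ).next n) n ≫ f = 0 := Iff.rfl

variable (P n Y)

/-- The class in the derived functor `Ext` of a cocycle. -/
def derivedClass : cocycles P n Y →ₗ[R] ExtM R n X Y :=
  (P.isoExt n Y).inv.hom ∘ₗ (P.complex.linearYonedaObj R Y).moduleCatClass n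

lemma derivedClass_surjective : Function.Surjective (derivedClass P n Y) :=
  ((ModuleCat.epi_iff_surjective (P.isoExt n Y).inv).1 inferInstance).comp
    (HomologicalComplex.moduleCatClass_surjective _ n)

lemma derivedClass_eq_zero_iff (z : cocycles P n Y) :
    derivedClass P n Y z = 0 ↔ ∃ y : P.complex.X ((ComplexShape.up ℕ).prev n) ⟶ Y,
      P.complex.d n ((ComplexShape.up ℕ).prev n) ≫ y = z.1 := by
  refine Iff.trans ?_ (HomologicalComplex.moduleCatClass_eq_zero_iff _ n z)
  refine map_eq_zero_iff (P.isoExt n Y).inv.hom ?_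
  exact (ModuleCat.mono_iff_injective (P.isoExt n Y).inv).1 inferInstance

lemma extMk_smul (r : R) (f : P.complex.X n ⟶ Y)
    (hf : P.complex.d ((ComplexShape.up ℕ).next n) n ≫ f = 0) :
    P.extMk (r • f) ((ComplexShape.up ℕ).next n) (by simp)
      (by rw [Linear.comp_smul, hf, smul_zero]) =
      r • P.extMk f ((ComplexShape.up ℕ).next n) (by simp) hf := by
  rw [Abelian.Ext.smul_eq_comp_mk₀, P.extMk_comp_mk₀]
  simp

/-- The class in the Yoneda `Ext` of a cocycle. -/
def yonedaClass : cocycles P n Y →ₗ[R] Abelian.Ext X Y n where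
  toFun z := P.extMk z.1 ((ComplexShape.up ℕ).next n) (by simp) z.2
  map_add' z w := (P.add_extMk _ _ _ _ _ _).symm
  map_smul' r z := extMk_smul P n Y r z.1 z.2

lemma yonedaClass_surjective : Function.Surjective (yonedaClass P n Y) := fun x ↦ by
  obtain ⟨f, hf, rfl⟩ := P.extMk_surjective x ((ComplexShape.up ℕ).next n) (by simp)
  exact ⟨⟨f, hf⟩, rfl⟩

lemma eq_zero_of_extMk_zero_eq_zero (f : P.complex.X 0 ⟶ Y)
    (hf : P.complex.d ((ComplexShape.up ℕ).next 0) 0 ≫ f = 0)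
    (h : P.extMk f ((ComplexShape.up ℕ).next 0) (by simp) hf = 0) : f = 0 := by
  rw [← P.extEquivCohomologyClass.apply_eq_iff_eq,
    ProjectiveResolution.extEquivCohomologyClass_extMk,
    ProjectiveResolution.extEquivCohomologyClass_zero,
    CochainComplex.HomComplex.CohomologyClass.mk_eq_zero_iff,
    CochainComplex.HomComplex.Cocycle.toSingleMk_mem_coboundaries_iff _ _ _ _ _ 1 (by simp)]
    at h
  obtain ⟨g, hg⟩ := h
  have h0 : IsZero (P.cochainComplex.X 1) :=
    P.cochainComplex.isZero_of_isStrictlyLE 0 1 (by lia)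
  rw [h0.eq_of_src g 0, comp_zero] at hg
  rw [← cancel_epi (P.cochainComplexXIso (-0) 0 rfl).hom, comp_zero]
  exact hg.symm

lemma yonedaClass_eq_zero_iff (z : cocycles P n Y) :
    yonedaClass P n Y z = 0 ↔ ∃ y : P.complex.X ((ComplexShape.up ℕ).prev n) ⟶ Y,
      P.complex.d n ((ComplexShape.up ℕ).prev n) ≫ y = z.1 := by
  cases n with
  | zero =>
    have h : (∃ y : P.complex.X ((ComplexShape.up ℕ).prev 0) ⟶ Y,
        P.complex.d 0 ((ComplexShape.up ℕ).prev 0) ≫ y = z.1) ↔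
          (show P.complex.X 0 ⟶ Y from z.1) = 0 := by
      rw [P.complex.shape _ _ (by simp)]
      simp only [zero_comp, exists_const]
      exact eq_comm
    rw [h]
    refine ⟨fun hz ↦ ?_, fun hz ↦ ?_⟩
    · exact eq_zero_of_extMk_zero_eq_zero P Y z.1 z.2 hz
    · have : z = 0 := Subtype.ext hz
      rw [this, map_zero]
  | succ p =>
    exact P.extMk_eq_zero_iff (Y := Y) z.1 ((ComplexShape.up ℕ).next (p + 1)) (by simp) z.2
      ((ComplexShape.up ℕ).prev (p + 1)) (by simp)

/-- The `Ext`-modules defined by deriving the Hom functor in the first variable agree with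
those defined in the derived category. -/
def extEquiv (n : ℕ) (X Y : ModuleCat.{u} R) : ExtM R n X Y ≃ₗ[R] Abelian.Ext X Y n :=
  ((derivedClass (projectiveResolution X) n Y).quotKerEquivOfSurjective
    (derivedClass_surjective _ n Y)).symm ≪≫ₗ
  Submodule.quotEquivOfEq _ _ (by
    ext z
    rw [LinearMap.mem_ker, LinearMap.mem_ker, derivedClass_eq_zero_iff,
      yonedaClass_eq_zero_iff]) ≪≫ₗ
  ((yonedaClass (projectiveResolution X) n Y).quotKerEquivOfSurjective
    (yonedaClass_surjective _ n Y))

lemma extEquiv_derivedClass (X : ModuleCat.{u} R) (z : cocycles (projectiveResolution X) n Y) :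
    extEquiv n X Y (derivedClass _ n Y z) = yonedaClass _ n Y z := by
  have : ((derivedClass (projectiveResolution X) n Y).quotKerEquivOfSurjective
    (derivedClass_surjective _ n Y)).symm (derivedClass _ n Y z) = Submodule.Quotient.mk z := by
    rw [LinearEquiv.symm_apply_eq]
    rfl
  simp only [extEquiv, LinearEquiv.trans_apply, this]
  rfl

lemma extEquiv_naturality {X X' : ModuleCat.{u} R} (f : X ⟶ X') (x : ExtM R n X' Y) :
    extEquiv n X Y ((((Ext R (ModuleCat.{u} R) n).map f.op).app Y) x) =
      (Abelian.Ext.mk₀ f).comp (extEquiv n X' Y x) (zero_add n) := by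
  obtain ⟨z, rfl⟩ := derivedClass_surjective (projectiveResolution X') n Y x
  let φ := ProjectiveResolution.lift f (projectiveResolution X) (projectiveResolution X')
  have hφ := ProjectiveResolution.lift_commutes f (projectiveResolution X)
    (projectiveResolution X')
  let Φ : ProjectiveResolution.Hom (projectiveResolution X) (projectiveResolution X') f :=
    ⟨φ, (HomologicalComplex.congr_hom hφ 0).trans (by simp)⟩
  have hw : (projectiveResolution X).complex.d ((ComplexShape.up ℕ).next n) n ≫
      (φ.f n ≫ (show (projectiveResolution X').complex.X n ⟶ Y from z.1)) = 0 := by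
    rw [← φ.comm_assoc, (mem_cocycles_iff _).1 z.2, comp_zero]
  let w : cocycles (projectiveResolution X) n Y := ⟨φ.f n ≫ z.1, hw⟩
  have h : (((Ext R (ModuleCat.{u} R) n).map f.op).app Y) (derivedClass _ n Y z) =
      derivedClass _ n Y w := by
    have h₁ := isoExt_inv_naturality Y f _ _ φ hφ n
    have h₂ := congrArg (fun g ↦ g.hom
      (HomologicalComplex.moduleCatClass _ n z)) h₁
    refine Eq.trans h₂ (congrArg ((projectiveResolution X).isoExt n Y).inv.hom ?_)
    exact HomologicalComplex.homologyMap_moduleCatClass (linearYonedaMap φ Y) z w rfl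
  rw [h, extEquiv_derivedClass, extEquiv_derivedClass]
  have hz : (projectiveResolution X').complex.d ((ComplexShape.up ℕ).next n) n ≫
      (show (projectiveResolution X').complex.X n ⟶ Y from z.1) = 0 := z.2
  exact (ProjectiveResolution.mk₀_comp_extMk _ _ (by simp) hz Φ).symm

end ExtComparison

namespace ExtVanishing

open Abelian

variable {R : Type u} [CommRing R]

lemma subsingleton_of_shortExact {S : ShortComplex (ModuleCat.{u} R)} (hS : S.ShortExact)
    {Y : ModuleCat.{u} R} {i : ℕ} (h₁ : Subsingleton (Abelian.Ext S.X₁ Y i))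
    (h₃ : Subsingleton (Abelian.Ext S.X₃ Y i)) : Subsingleton (Abelian.Ext S.X₂ Y i) := by
  refine subsingleton_of_forall_eq 0 fun x ↦ ?_
  obtain ⟨y, rfl⟩ := Abelian.Ext.contravariant_sequence_exact₂ hS Y x (Subsingleton.elim _ _)
  rw [Subsingleton.elim y 0, Abelian.Ext.comp_zero]

lemma subsingleton_of_iso {X X' : ModuleCat.{u} R} (e : X ≅ X') {Y : ModuleCat.{u} R} {i : ℕ}
    (h : Subsingleton (Abelian.Ext X' Y i)) : Subsingleton (Abelian.Ext X Y i) := by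
  refine subsingleton_of_forall_eq 0 fun x ↦ ?_
  have : (Abelian.Ext.mk₀ e.hom).comp ((Abelian.Ext.mk₀ e.inv).comp x (zero_add i))
      (zero_add i) = x := by simp
  rw [← this, Subsingleton.elim ((Abelian.Ext.mk₀ e.inv).comp x (zero_add i)) 0,
    Abelian.Ext.comp_zero]

/-- Vanishing of `Ext` in a range of degrees can be checked on the prime cyclic modules
in the support. -/
lemma subsingleton_ext_of_forall_mem_support [IsNoetherianRing R] (Y : ModuleCat.{u} R)
    (i : ℕ) (N : Type u) [AddCommGroup N] [Module R N] [Module.Finite R N]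
    (h : ∀ p ∈ Module.support R N,
      Subsingleton (Abelian.Ext (ModuleCat.of R (R ⧸ p.asIdeal)) Y i)) :
    Subsingleton (Abelian.Ext (ModuleCat.of R N) Y i) := by
  revert h
  induction ‹Module.Finite R N› using IsNoetherianRing.induction_on_isQuotientEquivQuotientPrime R
    with
  | subsingleton N =>
    intro _
    have h0 : 𝟙 (ModuleCat.of R N) = 0 := by ext; exact Subsingleton.elim _ _
    refine subsingleton_of_forall_eq 0 fun x ↦ ?_
    rw [← Abelian.Ext.mk₀_id_comp x, h0, Abelian.Ext.mk₀_zero, Abelian.Ext.zero_comp]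
  | quotient N p e =>
    intro h
    refine subsingleton_of_iso e.toModuleIso (h p ?_)
    rw [e.support_eq, Module.mem_support_iff_of_finite, Ideal.annihilator_quotient]
  | exact N₁ N₂ N₃ f g hf hg hfg h₁ h₃ =>
    intro h
    have hs := Module.support_of_exact hfg hf hg
    have hS : (ShortComplex.mk (ModuleCat.ofHom f) (ModuleCat.ofHom g)
        (by ext x; exact hfg.apply_apply_eq_zero x)).ShortExact :=
      ModuleCat.shortComplex_shortExact _ hfg hf hg
    exact subsingleton_of_shortExact hS (h₁ fun p hp ↦ h p (hs ▸ Or.inl hp))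
      (h₃ fun p hp ↦ h p (hs ▸ Or.inr hp))

lemma mk₀_smul_id_comp {M Y : ModuleCat.{u} R} (r : R) {i : ℕ} (ξ : Abelian.Ext M Y i) :
    (Abelian.Ext.mk₀ (r • 𝟙 M)).comp ξ (zero_add i) = r • ξ := by
  rw [Abelian.Ext.mk₀_smul, Abelian.Ext.smul_comp, Abelian.Ext.mk₀_id_comp]

lemma surjective_smul_ext {M Y : ModuleCat.{u} R} {x : R} (hx : IsSMulRegular M x) {i : ℕ}
    (h : Subsingleton (Abelian.Ext (ModuleCat.of R (QuotSMulTop x M)) Y (i + 1)))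
    (ξ : Abelian.Ext M Y i) : ∃ η : Abelian.Ext M Y i, x • η = ξ := by
  obtain ⟨η, hη⟩ := Abelian.Ext.contravariant_sequence_exact₁ hx.smulShortComplex_shortExact Y
    ξ (add_comm 1 i) (h.elim _ _)
  exact ⟨η, (mk₀_smul_id_comp x η).symm.trans hη⟩

lemma subsingleton_ext_quotient_prime [IsLocalRing R] [IsNoetherianRing R] (n : ℕ)
    (hn : ringKrullDim R = n) (Y : ModuleCat.{u} R) [Module.Finite R Y]
    (hk : ∀ i < n, Subsingleton (Abelian.Ext (ModuleCat.of R (R ⧸ maximalIdeal R)) Y i))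
    (d : ℕ) (p : PrimeSpectrum R) (hp : n ≤ Order.height p + d) (i : ℕ) (hi : i + d < n) :
    Subsingleton (Abelian.Ext (ModuleCat.of R (R ⧸ p.asIdeal)) Y i) := by
  by_cases hpm : p = closedPoint R
  · subst hpm
    exact hk i (by lia)
  have hlt : p < closedPoint R := lt_of_le_of_ne (IsLocalRing.le_maximalIdeal p.2.ne_top) hpm
  have hheight (q r : PrimeSpectrum R) (hqr : q < r) : Order.height q + 1 ≤ Order.height r :=
    Order.height_add_one_le hqr
  induction d generalizing p i with
  | zero =>
    have h₁ := hheight _ _ hlt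
    have h₂ : Order.height (closedPoint R) ≤ n := by
      have := Order.height_le_krullDim (closedPoint R)
      rw [← ringKrullDim, hn] at this
      exact_mod_cast this
    exfalso
    have h₃ : (n : ℕ∞) + 1 ≤ n := by
      calc (n : ℕ∞) + 1 ≤ Order.height p + 1 := by gcongr; simpa using hp
        _ ≤ _ := h₁.trans h₂
    exact absurd (by exact_mod_cast h₃ : n + 1 ≤ n) (by lia)
  | succ d ih =>
    obtain ⟨x, hxm, hxp⟩ := SetLike.exists_of_lt (show p.asIdeal < maximalIdeal R from hlt)
    have hreg : IsSMulRegular (ModuleCat.of R (R ⧸ p.asIdeal)) x := by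
      intro a b hab
      obtain ⟨a, rfl⟩ := Ideal.Quotient.mk_surjective a
      obtain ⟨b, rfl⟩ := Ideal.Quotient.mk_surjective b
      refine Ideal.Quotient.eq.2 ?_
      have : x * a - x * b ∈ p.asIdeal := Ideal.Quotient.eq.1 hab
      rw [← mul_sub] at this
      exact (p.2.mem_or_mem this).resolve_left hxp
    have hN : Subsingleton (Abelian.Ext (ModuleCat.of R (QuotSMulTop x
        (ModuleCat.of R (R ⧸ p.asIdeal)))) Y (i + 1)) := by
      refine subsingleton_ext_of_forall_mem_support Y (i + 1) _ fun q hq ↦ ?_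
      have hq' := Module.annihilator_le_of_mem_support hq
      have hpq : p < q := by
        refine lt_of_le_of_ne (fun y hy ↦ hq' ?_) ?_
        · rw [Module.mem_annihilator]
          intro m
          obtain ⟨m, rfl⟩ := Submodule.Quotient.mk_surjective _ m
          obtain ⟨a, rfl⟩ := Ideal.Quotient.mk_surjective m
          rw [← Submodule.Quotient.mk_smul]
          have : y • (Ideal.Quotient.mk p.asIdeal a) = 0 :=
            Ideal.Quotient.eq_zero_iff_mem.2 (p.asIdeal.mul_mem_right _ hy)
          exact congrArg _ this
        · rintro rfl
          refine hxp (hq' ?_)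
          rw [Module.mem_annihilator]
          intro m
          obtain ⟨m, rfl⟩ := Submodule.Quotient.mk_surjective _ m
          rw [← Submodule.Quotient.mk_smul, Submodule.Quotient.mk_eq_zero]
          exact Submodule.smul_mem_pointwise_smul _ _ _ trivial
      by_cases hqm : q = closedPoint R
      · subst hqm
        exact hk _ (by lia)
      refine ih q ?_ (i + 1) (by lia) hqm
        (lt_of_le_of_ne (IsLocalRing.le_maximalIdeal q.2.ne_top) hqm)
      calc (n : ℕ∞) ≤ Order.height p + (d + 1 : ℕ) := hp
        _ = (Order.height p + 1) + d := by push_cast; ring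
        _ ≤ Order.height q + d := by gcongr; exact hheight _ _ hpq
    have hsurj := surjective_smul_ext (Y := Y) hreg hN
    have htop : (⊤ : Submodule R (Abelian.Ext (ModuleCat.of R (R ⧸ p.asIdeal)) Y i)) = ⊥ := by
      refine Submodule.eq_bot_of_le_smul_of_le_jacobson_bot (maximalIdeal R) _
        (Module.Finite.fg_top) ?_ (IsLocalRing.maximalIdeal_le_jacobson _)
      rintro ξ -
      obtain ⟨η, rfl⟩ := hsurj ξ
      exact Submodule.smul_mem_smul hxm trivial
    exact (Submodule.subsingleton_iff R).1 (subsingleton_of_top_eq_bot htop)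

/-- Over a local ring of dimension `n` with `Ext^i(k, Y) = 0` for `i < n`, the grade of a finite
module supported in `V(I)` is at least the height of `I`. -/
lemma subsingleton_ext_of_lt_height [IsLocalRing R] [IsNoetherianRing R] (n : ℕ)
    (hn : ringKrullDim R = n) (Y : ModuleCat.{u} R) [Module.Finite R Y]
    (hk : ∀ i < n, Subsingleton (Abelian.Ext (ModuleCat.of R (R ⧸ maximalIdeal R)) Y i))
    (I : Ideal R) (c : ℕ) (hc : idealHeight R I = c)
    (N : Type u) [AddCommGroup N] [Module R N] [Module.Finite R N]
    (s : ℕ) (hN : I ^ s ≤ Module.annihilator R N) (i : ℕ) (hi : i < c) :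
    Subsingleton (Abelian.Ext (ModuleCat.of R N) Y i) := by
  refine subsingleton_ext_of_forall_mem_support Y i N fun p hp ↦ ?_
  have hle : (c : ℕ∞) ≤ Order.height p := hc ▸
    iInf_le (fun p : {p : PrimeSpectrum R // I ≤ p.asIdeal} ↦ Order.height (p : PrimeSpectrum R))
      ⟨p, p.2.le_of_pow_le (hN.trans (Module.annihilator_le_of_mem_support hp))⟩
  have hcn : c ≤ n := by
    have := Order.height_le_krullDim p
    rw [← ringKrullDim, hn] at this
    have h : (c : WithBot ℕ∞) ≤ n := le_trans (by exact_mod_cast hle) this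
    exact_mod_cast h
  refine subsingleton_ext_quotient_prime n hn Y hk (n - c) p ?_ i (by lia)
  calc (n : ℕ∞) = (c : ℕ∞) + (n - c : ℕ) := by norm_cast; lia
    _ ≤ _ := by gcongr

end ExtVanishing

namespace ExtVanishing

variable {R : Type u} [CommRing R]

lemma eq_zero_of_mk₀_comp_eq_zero {S : ShortComplex (ModuleCat.{u} R)} (hS : S.ShortExact)
    {Y : ModuleCat.{u} R} {c : ℕ} (h : ∀ i < c, Subsingleton (Abelian.Ext S.X₁ Y i))
    (ξ : Abelian.Ext S.X₃ Y c) (hξ : (Abelian.Ext.mk₀ S.g).comp ξ (zero_add c) = 0) :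
    ξ = 0 := by
  cases c with
  | zero =>
    have := hS.epi_g
    exact Abelian.Ext.precomp_mk₀_injective_of_epi Y S.g
      (hξ.trans (map_zero ((Abelian.Ext.mk₀ S.g).precomp Y (zero_add 0))).symm)
  | succ c =>
    obtain ⟨η, rfl⟩ := Abelian.Ext.contravariant_sequence_exact₃ hS Y ξ hξ (add_comm 1 c)
    rw [(h c (Nat.lt_succ_self c)).elim η 0, Abelian.Ext.comp_zero]

/-- If `Ext` vanishes below degree `c` on finite modules killed by the annihilator of `N`, then a
class in `Ext^c(N, Y)` killed by an ideal `J` comes from any quotient of `N` by `JN`. -/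
lemma exists_comp_eq_of_forall_smul_eq_zero [IsNoetherianRing R] {N Q : Type u}
    [AddCommGroup N] [Module R N] [Module.Finite R N] [AddCommGroup Q] [Module R Q]
    (Y : ModuleCat.{u} R) (c : ℕ)
    (h : ∀ (L : Type u) [AddCommGroup L] [Module R L] [Module.Finite R L],
      Module.annihilator R N ≤ Module.annihilator R L →
        ∀ i < c, Subsingleton (Abelian.Ext (ModuleCat.of R L) Y i))
    (J : Ideal R) (g : N →ₗ[R] Q) (hg : Function.Surjective g)
    (hker : LinearMap.ker g = J • (⊤ : Submodule R N))
    (ξ : Abelian.Ext (ModuleCat.of R N) Y c) (hξ : ∀ a ∈ J, a • ξ = 0) :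
    ∃ ζ : Abelian.Ext (ModuleCat.of R Q) Y c,
      (Abelian.Ext.mk₀ (ModuleCat.ofHom g)).comp ζ (zero_add c) = ξ := by
  refine Abelian.Ext.contravariant_sequence_exact₂ (LinearMap.shortExact_shortComplexKer hg)
    Y ξ ?_
  obtain ⟨r, a, ha⟩ := Submodule.fg_iff_exists_fin_generating_family.1
    ((isNoetherianRing_iff_ideal_fg R).1 inferInstance J)
  have haJ (k : Fin r) : a k ∈ J := ha ▸ Submodule.subset_span ⟨k, rfl⟩
  let π : (Fin r → N) →ₗ[R] LinearMap.ker g :=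
    LinearMap.codRestrict _ (∑ k, a k • LinearMap.proj k) fun x ↦ by
      rw [hker, LinearMap.sum_apply]
      exact sum_mem fun k _ ↦ Submodule.smul_mem_smul (haJ k) trivial
  have hπ : Function.Surjective π := by
    rintro ⟨y, hy⟩
    rw [hker, ← ha] at hy
    suffices ∃ x, (∑ k, a k • LinearMap.proj (φ := fun _ : Fin r ↦ N) (R := R) k) x = y by
      obtain ⟨x, hx⟩ := this
      exact ⟨x, Subtype.ext hx⟩
    rw [← LinearMap.mem_range]
    rw [Submodule.span_smul_eq, Submodule.set_smul_eq_iSup] at hy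
    refine (iSup₂_le ?_ : _ ≤ LinearMap.range _) hy
    rintro _ ⟨k, rfl⟩ y hy
    obtain ⟨z, -, rfl⟩ := hy
    refine ⟨Pi.single k z, ?_⟩
    simp [LinearMap.sum_apply, Pi.single_apply]
  refine eq_zero_of_mk₀_comp_eq_zero (LinearMap.shortExact_shortComplexKer hπ) ?_ _ ?_
  · refine h (LinearMap.ker π) ?_
    refine le_trans ?_
      (LinearMap.annihilator_le_of_injective _ (LinearMap.ker π).injective_subtype)
    intro b hb
    rw [Module.mem_annihilator] at hb ⊢
    exact fun x ↦ funext fun k ↦ hb _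
  · have hcomp : ModuleCat.ofHom π ≫ ModuleCat.ofHom (LinearMap.ker g).subtype =
        ∑ k : Fin r, ModuleCat.ofHom (LinearMap.proj (φ := fun _ : Fin r ↦ N) (R := R) k) ≫
          (a k • 𝟙 (ModuleCat.of R N)) := by
      ext x
      simp [π]
    change (Abelian.Ext.mk₀ (ModuleCat.ofHom π)).comp
      ((Abelian.Ext.mk₀ (ModuleCat.ofHom (LinearMap.ker g).subtype)).comp ξ (zero_add c))
        (zero_add c) = 0
    rw [Abelian.Ext.mk₀_comp_mk₀_assoc, hcomp, Abelian.Ext.mk₀_sum, Abelian.Ext.sum_comp]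
    refine Finset.sum_eq_zero fun k _ ↦ ?_
    rw [← Abelian.Ext.mk₀_comp_mk₀_assoc, mk₀_smul_id_comp, hξ _ (haJ k),
      Abelian.Ext.comp_zero]

end ExtVanishing

section AdicCompleteness

variable {R : Type*} [CommRing R] (J : Ideal R)

lemma IsPrecomplete.of_surjective_linearMap {M N : Type*} [AddCommGroup M] [Module R M]
    [AddCommGroup N] [Module R N] [IsPrecomplete J M] (f : M →ₗ[R] N)
    (hf : Function.Surjective f) : IsPrecomplete J N := by
  rw [← AdicCompletion.of_surjective_iff]
  intro y
  obtain ⟨x, rfl⟩ := AdicCompletion.map_surjective J hf y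
  obtain ⟨x, rfl⟩ := AdicCompletion.of_surjective J M x
  exact ⟨f x, (AdicCompletion.map_of J f x).symm⟩

lemma IsPrecomplete.of_finite [IsPrecomplete J R] (M : Type*) [AddCommGroup M] [Module R M]
    [Module.Finite R M] : IsPrecomplete J M := by
  rw [← AdicCompletion.of_surjective_iff]
  intro y
  obtain ⟨x, rfl⟩ := AdicCompletion.ofTensorProduct_surjective_of_finite J M y
  induction x using TensorProduct.induction_on with
  | zero => exact ⟨0, by simp⟩
  | tmul r m =>
    obtain ⟨r, rfl⟩ := AdicCompletion.of_surjective J R r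
    refine ⟨r • m, ?_⟩
    rw [AdicCompletion.ofTensorProduct_tmul, map_smul]
    ext n
    rfl
  | add x y hx hy =>
    obtain ⟨a, ha⟩ := hx
    obtain ⟨b, hb⟩ := hy
    exact ⟨a + b, by rw [map_add, map_add, ha, hb]⟩

/-- A module that is closed, for the adic topology, in a product of complete modules is
complete. -/
lemma IsAdicComplete.of_closed {E : Type*} [AddCommGroup E] [Module R E] (hJ : J.FG)
    {A : Type*} {M : A → Type*} [∀ a, AddCommGroup (M a)] [∀ a, Module R (M a)]
    [∀ a, IsAdicComplete J (M a)] (ev : ∀ a, E →ₗ[R] M a)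
    (hinj : Function.Injective (LinearMap.pi ev))
    (hclosed : ∀ (v : ∀ a, M a) (f : ℕ → E),
      (∀ a k, ev a (f k) ≡ v a [SMOD (J ^ k • ⊤ : Submodule R (M a))]) → ∃ e, ∀ a, ev a e = v a) :
    IsAdicComplete J E := by
  have hmap (a : A) (k : ℕ) {e : E} (he : e ∈ (J ^ k • ⊤ : Submodule R E)) :
      ev a e ∈ (J ^ k • ⊤ : Submodule R (M a)) := by
    have := Submodule.mem_map_of_mem (f := ev a) he
    rw [Submodule.map_smul''] at this
    exact Submodule.smul_mono le_rfl le_top this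
  refine { haus' := fun e he ↦ hinj (funext fun a ↦ ?_), prec' := ?_ }
  · refine (IsHausdorff.haus' (I := J) (ev a e) fun k ↦ ?_).trans (map_zero (ev a)).symm
    exact SModEq.zero.2 (hmap a k (SModEq.zero.1 (he k)))
  let ofEquiv (a : A) : M a ≃ₗ[R] AdicCompletion J (M a) :=
    LinearEquiv.ofBijective (AdicCompletion.of J (M a))
      (AdicCompletion.of_bijective_iff.2 inferInstance)
  let φ : AdicCompletion J E →ₗ[R] ∀ a, M a := LinearMap.pi fun a ↦
    (ofEquiv a).symm.toLinearMap ∘ₗ (AdicCompletion.map J (ev a)).restrictScalars R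
  have hφ (x : AdicCompletion J E) (a : A) :
      AdicCompletion.of J (M a) (φ x a) = AdicCompletion.map J (ev a) x :=
    (ofEquiv a).apply_symm_apply _
  have hrange (x : AdicCompletion J E) : φ x ∈ LinearMap.range (LinearMap.pi ev) := by
    choose f hf using fun k ↦ Submodule.Quotient.mk_surjective _ (x.val k)
    obtain ⟨e, he⟩ := hclosed (φ x) f fun a k ↦ by
      have h := congrArg (fun z ↦ z.val k) (hφ x a)
      refine Eq.trans ?_ h.symm
      exact congrArg ((ev a).reduceModIdeal (J ^ k)) (hf k)
    exact ⟨e, funext he⟩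
  let ρ : AdicCompletion J E →ₗ[R] E :=
    (LinearEquiv.ofInjective _ hinj).symm.toLinearMap ∘ₗ φ.codRestrict _ hrange
  have hρ (e : E) : ρ (AdicCompletion.of J E e) = e := by
    refine (LinearEquiv.symm_apply_eq _).2 (Subtype.ext (funext fun a ↦ ?_))
    refine AdicCompletion.of_injective J (M a) ((hφ _ a).trans ?_)
    exact AdicCompletion.map_of J (ev a) e
  have := (AdicCompletion.isAdicComplete (M := E) hJ).toIsPrecomplete
  exact (IsPrecomplete.of_surjective_linearMap J ρ fun e ↦ ⟨_, hρ e⟩).prec'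

/-- The endomorphism ring of an increasing union of fully invariant finite submodules over a
complete Noetherian ring is complete. -/
lemma IsAdicComplete.moduleEnd [IsNoetherianRing R] [IsAdicComplete J R] {H : Type*}
    [AddCommGroup H] [Module R H] (F : ℕ → Submodule R H) (hF : Monotone F)
    (hfg : ∀ t, (F t).FG) (hunion : ∀ h, ∃ t, h ∈ F t)
    (hinv : ∀ (f : Module.End R H) (t : ℕ), ∀ h ∈ F t, f h ∈ F t) :
    IsAdicComplete J (Module.End R H) := by
  have hfin (t : ℕ) : Module.Finite R (F t) := Module.Finite.iff_fg.2 (hfg t)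
  have hcompl (t : ℕ) : IsAdicComplete J (F t) :=
    { toIsHausdorff := IsHausdorff.of_le_jacobson J _ (IsAdicComplete.le_jacobson_bot J)
      toIsPrecomplete := IsPrecomplete.of_finite J _ }
  let ev (a : Σ t, F t) : Module.End R H →ₗ[R] F a.1 :=
    LinearMap.codRestrict (F a.1) (LinearMap.applyₗ (a.2 : H)) fun f ↦ hinv f a.1 _ a.2.2
  refine IsAdicComplete.of_closed J (IsNoetherian.noetherian J) ev (fun f g hfg' ↦ ?_) ?_
  · ext h
    obtain ⟨t, ht⟩ := hunion h
    exact congrArg Subtype.val (congrFun hfg' ⟨t, h, ht⟩)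
  · intro v f hv
    have hincl {s t : ℕ} (hst : s ≤ t) (h : F s) :
        (v ⟨t, Submodule.inclusion (hF hst) h⟩ : H) = v ⟨s, h⟩ := by
      suffices v ⟨t, Submodule.inclusion (hF hst) h⟩ = Submodule.inclusion (hF hst) (v ⟨s, h⟩) from
        congrArg Subtype.val this
      refine (IsHausdorff.eq_iff_smodEq (I := J)).2 fun k ↦ (hv _ k).symm.trans ?_
      have := Submodule.mem_map_of_mem (f := Submodule.inclusion (hF hst))
        (SModEq.sub_mem.1 (hv ⟨s, h⟩ k))
      rw [Submodule.map_smul''] at this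
      exact SModEq.sub_mem.2 (Submodule.smul_mono le_rfl le_top this)
    have hadd (t : ℕ) (h h' : F t) : v ⟨t, h + h'⟩ = v ⟨t, h⟩ + v ⟨t, h'⟩ := by
      refine (IsHausdorff.eq_iff_smodEq (I := J)).2 fun k ↦ (hv _ k).symm.trans ?_
      refine Eq.trans ?_ ((hv ⟨t, h⟩ k).add (hv ⟨t, h'⟩ k))
      exact congrArg _ (Subtype.ext (map_add (f k) _ _))
    have hsmul (t : ℕ) (r : R) (h : F t) : v ⟨t, r • h⟩ = r • v ⟨t, h⟩ := by
      refine (IsHausdorff.eq_iff_smodEq (I := J)).2 fun k ↦ (hv _ k).symm.trans ?_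
      refine Eq.trans ?_ ((hv ⟨t, h⟩ k).smul r)
      exact congrArg _ (Subtype.ext (map_smul (f k) _ _))
    choose τ hτ using hunion
    have hval (t : ℕ) (h : H) (ht : h ∈ F t) :
        (v ⟨τ h, h, hτ h⟩ : H) = v ⟨t, h, ht⟩ :=
      (hincl (le_max_left (τ h) t) ⟨h, hτ h⟩).symm.trans (hincl (le_max_right (τ h) t) ⟨h, ht⟩)
    refine ⟨⟨⟨fun h ↦ v ⟨τ h, h, hτ h⟩, fun h h' ↦ ?_⟩, fun r h ↦ ?_⟩, fun ⟨t, h⟩ ↦ ?_⟩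
    · have h₁ := hF (le_max_left (τ h) (τ h')) (hτ h)
      have h₂ := hF (le_max_right (τ h) (τ h')) (hτ h')
      rw [hval _ _ h₁, hval _ _ h₂, hval _ _ (add_mem h₁ h₂)]
      exact congrArg Subtype.val (hadd _ ⟨h, h₁⟩ ⟨h', h₂⟩)
    · refine (hval _ _ ((F (τ h)).smul_mem r (hτ h))).trans ?_
      exact congrArg Subtype.val (hsmul _ r ⟨h, hτ h⟩)
    · exact Subtype.ext (hval t h h.2)

end AdicCompleteness

namespace LocalCohomologySystem

variable {R : Type u} [CommRing R] (I : Ideal R)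

/-- The projection `R/I^s → R/I^t` for `t ≤ s`. -/
abbrev powProj {t s : ℕ} (h : t ≤ s) :
    ModuleCat.of R (R ⧸ I ^ s) ⟶ ModuleCat.of R (R ⧸ I ^ t) :=
  ModuleCat.ofHom (Submodule.mapQ _ _ LinearMap.id (Ideal.pow_le_pow_right h))

section

variable {K : Type} [SmallCategory K] [IsFiltered K] {G : K ⥤ ModuleCat.{u} R} {C : Cocone G}

lemma exists_rep_of_isColimit (hC : IsColimit C) (h : C.pt) : ∃ t ξ, C.ι.app t ξ = h :=
  have : PreservesFilteredColimitsOfSize.{0, 0} (forget (ModuleCat.{u} R)) :=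
    preservesSmallestFilteredColimits_of_preservesFilteredColimits _
  Concrete.isColimit_exists_rep G hC h

lemma exists_map_eq_zero_of_isColimit (hC : IsColimit C) {t : K} (ξ : G.obj t)
    (h : C.ι.app t ξ = 0) : ∃ s, ∃ f : t ⟶ s, G.map f ξ = 0 := by
  have : PreservesFilteredColimitsOfSize.{0, 0} (forget (ModuleCat.{u} R)) :=
    preservesSmallestFilteredColimits_of_preservesFilteredColimits _
  obtain ⟨s, f, g, hfg⟩ := (Concrete.isColimit_rep_eq_iff_exists G hC ξ 0).1
    (h.trans (map_zero _).symm)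
  exact ⟨s, f, hfg.trans (map_zero _)⟩

end

/-- Local cohomology is the direct limit of the modules `Ext^c(R/I^t, Y)`. -/
lemma exists_system (c : ℕ) (Y : ModuleCat.{u} R) :
    ∃ ι : ∀ t, Abelian.Ext (ModuleCat.of R (R ⧸ I ^ t)) Y c →ₗ[R] LC R I c Y,
      (∀ h, ∃ t ξ, ι t ξ = h) ∧
      (∀ {t s : ℕ} (h : t ≤ s) (ξ), ι s ((Abelian.Ext.mk₀ (powProj I h)).comp ξ (zero_add c)) =
        ι t ξ) ∧
      ∀ (t : ℕ) (ξ), ι t ξ = 0 → ∃ (s : ℕ) (h : t ≤ s),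
        (Abelian.Ext.mk₀ (powProj I h)).comp ξ (zero_add c) = 0 := by
  let D := localCohomology.diagram (localCohomology.idealPowersDiagram I) c
  have := localCohomology.hasColimitDiagram (localCohomology.idealPowersDiagram I) c
  let E := (evaluation (ModuleCat.{u} R) (ModuleCat.{u} R)).obj Y
  let C : Cocone (D ⋙ E) := E.mapCocone (colimit.cocone D)
  let hC : IsColimit C := isColimitOfPreserves E (colimit.isColimit D)
  let e (t : ℕ) : ExtM R c (ModuleCat.of R (R ⧸ I ^ t)) Y ≃ₗ[R]
    Abelian.Ext (ModuleCat.of R (R ⧸ I ^ t)) Y c := ExtComparison.extEquiv c _ Y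
  let j (t : ℕ) : (ℕᵒᵖ)ᵒᵖ := op (op t)
  let w {t s : ℕ} (h : t ≤ s) : j t ⟶ j s := (homOfLE h).op.op
  have hmap {t s : ℕ} (h : t ≤ s) (ξ : ExtM R c (ModuleCat.of R (R ⧸ I ^ t)) Y) :
      e s ((D ⋙ E).map (w h) ξ) = (Abelian.Ext.mk₀ (powProj I h)).comp (e t ξ) (zero_add c) :=
    ExtComparison.extEquiv_naturality c Y (powProj I h) ξ
  refine ⟨fun t ↦ (C.ι.app (j t)).hom ∘ₗ (e t).symm.toLinearMap, fun h ↦ ?_, fun {t s} h ξ ↦ ?_,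
    fun t ξ h ↦ ?_⟩
  · obtain ⟨t, ξ, hξ⟩ := exists_rep_of_isColimit hC h
    refine ⟨t.unop.unop, e _ ξ, ?_⟩
    exact (congrArg (C.ι.app t) ((e _).symm_apply_apply ξ)).trans hξ
  · obtain ⟨ξ, rfl⟩ := (e t).surjective ξ
    have h₁ := (e s).symm_apply_eq.2 (hmap h ξ).symm
    refine (congrArg (C.ι.app (j s)) h₁).trans ?_
    refine Eq.trans ?_ (congrArg (C.ι.app (j t)) ((e t).symm_apply_apply ξ)).symm
    exact ConcreteCategory.congr_hom (C.w (w h)) ξ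
  · obtain ⟨s, f, hf⟩ := exists_map_eq_zero_of_isColimit hC (t := j t) ((e t).symm ξ) h
    have hs : t ≤ s.unop.unop := leOfHom f.unop.unop
    refine ⟨s.unop.unop, hs, ?_⟩
    have h₁ := hmap hs ((e t).symm ξ)
    rw [LinearEquiv.apply_symm_apply] at h₁
    rw [← h₁]
    exact (congrArg (e s.unop.unop) hf).trans (map_zero _)

end LocalCohomologySystem

namespace LocalCohomologySystem

variable {R : Type u} [CommRing R] (I : Ideal R)

lemma smul_ext_eq_zero {t c : ℕ} {Y : ModuleCat.{u} R} {a : R} (ha : a ∈ I ^ t)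
    (ξ : Abelian.Ext (ModuleCat.of R (R ⧸ I ^ t)) Y c) : a • ξ = 0 := by
  have h : a • 𝟙 (ModuleCat.of R (R ⧸ I ^ t)) = 0 := by
    ext
    exact Ideal.Quotient.eq_zero_iff_mem.2 ((I ^ t).mul_mem_right _ ha)
  rw [← ExtVanishing.mk₀_smul_id_comp, h, Abelian.Ext.mk₀_zero, Abelian.Ext.zero_comp]

lemma ker_mapQ_pow {t s : ℕ} (h : t ≤ s) :
    LinearMap.ker (Submodule.mapQ (I ^ s) (I ^ t) LinearMap.id (Ideal.pow_le_pow_right h)) =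
      I ^ t • (⊤ : Submodule R (R ⧸ I ^ s)) := by
  rw [Submodule.mapQ, Submodule.ker_liftQ, LinearMap.comp_id, Submodule.ker_mkQ,
    ← Submodule.range_mkQ, ← Submodule.map_top, ← Submodule.map_smul'', Ideal.smul_eq_mul,
    Ideal.mul_top]

/-- If `Ext` vanishes below degree `c` on finite modules killed by a power of `I`, then the
`I^t`-torsion of `H^c_I(Y)` is the image of `Ext^c(R/I^t, Y)`, hence finitely generated. -/
lemma torsionBySet_fg [IsNoetherianRing R] (c : ℕ) (Y : ModuleCat.{u} R) [Module.Finite R Y]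
    (hv : ∀ (L : Type u) [AddCommGroup L] [Module R L] [Module.Finite R L] (s : ℕ),
      I ^ s ≤ Module.annihilator R L →
        ∀ i < c, Subsingleton (Abelian.Ext (ModuleCat.of R L) Y i)) :
    (∀ t : ℕ, (Submodule.torsionBySet R (LC R I c Y) (I ^ t : Ideal R)).FG) ∧
      ∀ h : LC R I c Y, ∃ t : ℕ, h ∈ Submodule.torsionBySet R (LC R I c Y) (I ^ t : Ideal R) := by
  obtain ⟨ι, hsurj, hcompat, hzero⟩ := exists_system I c Y
  refine ⟨fun t ↦ ?_, fun h ↦ ?_⟩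
  · have : IsNoetherian R (LinearMap.range (ι t)) :=
      isNoetherian_of_isNoetherianRing_of_finite R _
    refine Submodule.FG.of_le_of_isNoetherian (T := LinearMap.range (ι t)) fun h hh ↦ ?_
    obtain ⟨s₀, ξ₀, rfl⟩ := hsurj h
    rw [← hcompat (le_max_left s₀ t)] at hh ⊢
    generalize (Abelian.Ext.mk₀ (powProj I (le_max_left s₀ t))).comp ξ₀ (zero_add c) = ξ at hh ⊢
    generalize hs : max s₀ t = s at ξ hh ⊢
    have hts : t ≤ s := hs ▸ le_max_right s₀ t
    rw [Submodule.mem_torsionBySet_iff] at hh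
    let ξ' (k : ℕ) := (Abelian.Ext.mk₀ (powProj I (Nat.le_add_right s k))).comp ξ (zero_add c)
    have hkill (a : R) (ha : a ∈ I ^ t) : ∃ k, ∀ l ≥ k, a • ξ' l = 0 := by
      obtain ⟨s', hs', h₀⟩ := hzero s (a • ξ) (by rw [map_smul]; exact hh ⟨a, ha⟩)
      refine ⟨s' - s, fun l hl ↦ ?_⟩
      have h₁ : powProj I (show s' ≤ s + l by lia) ≫ powProj I hs' =
          powProj I (Nat.le_add_right s l) := by
        ext; rfl
      rw [← Abelian.Ext.comp_smul, ← h₁, ← Abelian.Ext.mk₀_comp_mk₀_assoc, h₀,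
        Abelian.Ext.comp_zero]
    obtain ⟨S, hS⟩ := (isNoetherianRing_iff_ideal_fg R).1 inferInstance (I ^ t)
    choose! k hk using hkill
    have hann : ∀ a ∈ I ^ t, a • ξ' (S.sup k) = 0 := by
      intro a ha
      rw [← hS] at ha
      induction ha using Submodule.span_induction with
      | mem x hx => exact hk x (hS ▸ Submodule.subset_span hx) _ (Finset.le_sup hx)
      | zero => exact zero_smul _ _
      | add x y _ _ hx hy => rw [add_smul, hx, hy, add_zero]
      | smul r x _ hx => rw [smul_assoc, hx, smul_zero]
    have hts' : t ≤ s + S.sup k := by lia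
    obtain ⟨ζ, hζ⟩ := ExtVanishing.exists_comp_eq_of_forall_smul_eq_zero Y c
      (fun L _ _ _ hL ↦ hv L (s + S.sup k) (by rwa [Ideal.annihilator_quotient] at hL)) (I ^ t)
      (Submodule.mapQ _ _ LinearMap.id (Ideal.pow_le_pow_right hts'))
      (fun x ↦ by
        obtain ⟨x, rfl⟩ := Submodule.Quotient.mk_surjective _ x
        exact ⟨Submodule.Quotient.mk x, rfl⟩)
      (ker_mapQ_pow I hts') (ξ' (S.sup k)) hann
    refine ⟨ζ, ?_⟩
    rw [← hcompat hts', ← hcompat (Nat.le_add_right s (S.sup k)) ξ]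
    exact congrArg _ hζ
  · obtain ⟨t, ξ, rfl⟩ := hsurj h
    refine ⟨t, (Submodule.mem_torsionBySet_iff _ _).2 fun a ↦ ?_⟩
    change a.1 • ι t ξ = 0
    rw [← map_smul, smul_ext_eq_zero I a.2, map_zero]

end LocalCohomologySystem

/-- Let `(R, 𝔪)` be a complete `n`-dimensional Gorenstein local ring
and `I ⊆ R` an ideal of height `c`.  Then the endomorphism ring
`B = Hom_R(H^c_I(R), H^c_I(R))` is `𝔪`-adically complete, i.e. the natural map
`B → lim_α B/𝔪^α B` is an isomorphism. -/
theorem endo_ring_of_localCohomology_adicComplete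
    (R : Type u) [CommRing R] [IsLocalRing R]
    (hGor : IsGorensteinLocalRing R) (hComplete : IsAdicComplete (maximalIdeal R) R)
    (n : ℕ) (hn : ringKrullDim R = n)
    (I : Ideal R) (c : ℕ) (hc : idealHeight R I = c) :
    IsAdicComplete (maximalIdeal R) (Module.End R ↥(LC R I c (ModuleCat.of R R))) := by
  obtain ⟨_, n', hn', hvan, -⟩ := hGor
  have : Module.Finite R (ModuleCat.of R R) := inferInstanceAs (Module.Finite R R)
  obtain ⟨hfg, hunion⟩ := LocalCohomologySystem.torsionBySet_fg I c (ModuleCat.of R R)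
    fun L _ _ _ s hL i hi ↦ ExtVanishing.subsingleton_ext_of_lt_height n' hn' _
      (fun i hi ↦ have := hvan i hi.ne
        (ExtComparison.extEquiv i _ _).symm.toEquiv.subsingleton) I c hc L s hL i hi
  refine IsAdicComplete.moduleEnd (maximalIdeal R)
    (fun t ↦ Submodule.torsionBySet R _ (I ^ t : Ideal R)) (fun s t hst ↦ ?_) hfg hunion
    fun f t h hh ↦ ?_
  · exact Submodule.torsionBySet_le_torsionBySet_of_subset (Ideal.pow_le_pow_right hst)
  · rw [Submodule.mem_torsionBySet_iff] at hh ⊢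
    exact fun a ↦ (map_smul f a.1 h).symm.trans ((congrArg f (hh a)).trans (map_zero f))
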